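/- arXiv:1506.05337 — 6 statements merged into one kernel-verified Lean document; each statement's English description precedes it below -/
import Mathlib

section
/- Knight's identity: for every τ ∈ ℝ and all real numbers x and y, l_τ(x − y) − l_τ(x) = −y·(τ − 1{x ≤ 0}) + y·∫₀¹ (1{x ≤ ys} − 1{x ≤ 0}) ds, where the integral is the Lebesgue integral over s ∈ [0,1]. -/
/-- The check function `l_τ(u) = u·(τ − 1{u ≤ 0})`. -/
noncomputable def checkFn (τ u : ℝ) : ℝ := u * (τ - if u ≤ 0 then 1 else 0)

theorem intervalIntegrable_ite_le (x a b : ℝ) :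
    IntervalIntegrable (fun t : ℝ => if x ≤ t then (1:ℝ) else 0) MeasureTheory.volume a b := by
  refine Monotone.intervalIntegrable fun s t hst => ?_
  split_ifs <;> linarith

theorem integral_ite_le (x a b : ℝ) :
    ∫ t in a..b, (if x ≤ t then (1:ℝ) else 0) = max (b - x) 0 - max (a - x) 0 := by
  refine MeasureTheory.integral_eq_of_hasDerivAt_off_countable
    (fun t => max (t - x) 0) _ (Set.countable_singleton x) (by fun_prop) ?_
    (intervalIntegrable_ite_le x a b)
  rintro t ⟨-, ht⟩
  rcases lt_or_gt_of_ne (show t ≠ x from ht) with h | h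
  · rw [if_neg h.not_ge]
    refine (hasDerivAt_const t (0:ℝ)).congr_of_eventuallyEq ?_
    filter_upwards [eventually_lt_nhds h] with s hs
    exact max_eq_right (by linarith)
  · rw [if_pos h.le]
    refine ((hasDerivAt_id t).sub_const x).congr_of_eventuallyEq ?_
    filter_upwards [eventually_gt_nhds h] with s hs
    exact max_eq_left (sub_nonneg.2 hs.le)

/-- Knight's identity. -/
theorem knight_identity (τ x y : ℝ) :
    checkFn τ (x - y) - checkFn τ x
      = -y * (τ - if x ≤ 0 then 1 else 0)
        + y * ∫ s in (0:ℝ)..1,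
            ((if x ≤ y * s then (1:ℝ) else 0) - (if x ≤ 0 then 1 else 0)) := by
  rw [intervalIntegral.mul_integral_comp_mul_left
      (f := fun t => (if x ≤ t then (1:ℝ) else 0) - (if x ≤ 0 then 1 else 0)),
    intervalIntegral.integral_sub (intervalIntegrable_ite_le x _ _) intervalIntegrable_const,
    integral_ite_le, intervalIntegral.integral_const]
  simp only [checkFn, mul_zero, mul_one, sub_zero, zero_sub, smul_eq_mul, max_def]
  split_ifs <;> linarith
end

section
/- Nonnegativity and localization of the Knight remainder: for every τ ∈ ℝ and all real numbers x and y, 0 ≤ l_τ(x − y) − l_τ(x) + y·(τ − 1{x ≤ 0}) ≤ |y|·1{|x| ≤ |y|}. -/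
/-- Nonnegativity and localization of the Knight remainder. -/
theorem knight_remainder_bounds (τ x y : ℝ) :
    0 ≤ checkFn τ (x - y) - checkFn τ x + y * (τ - if x ≤ 0 then 1 else 0) ∧
    checkFn τ (x - y) - checkFn τ x + y * (τ - if x ≤ 0 then 1 else 0)
      ≤ |y| * (if |x| ≤ |y| then 1 else 0) := by
  have remainder : checkFn τ (x - y) - checkFn τ x + y * (τ - if x ≤ 0 then 1 else 0) =
      (x - y) * ((if x ≤ 0 then 1 else 0) - if x - y ≤ 0 then 1 else 0) := by
    unfold checkFn
    ring
  rw [remainder]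
  rcases abs_cases x with ⟨hx, _⟩ | ⟨hx, _⟩ <;> rcases abs_cases y with ⟨hy, _⟩ | ⟨hy, _⟩ <;>
    rw [hx, hy] <;> split_ifs <;> constructor <;> linarith
end

section
/- Bracketing of the Knight remainder functional: for every δ > 0 and all real numbers x, y, z with z·y ≥ 0, it holds that μ_δ^L(x,y,z) ≤ μ(x,y,z) ≤ μ_δ^U(x,y,z). -/
/-- Lower smoothed indicator `1_δ^L`. -/
noncomputable def indL (δ x : ℝ) : ℝ :=
  (1 - min (x / δ) 1) * (if 0 < x then 1 else 0) + (if x ≤ 0 then 1 else 0)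

/-- Upper smoothed indicator `1_δ^U`. -/
noncomputable def indU (δ x : ℝ) : ℝ :=
  (1 - min (x / δ + 1) 1) * (if 0 < x + δ then 1 else 0) + (if x + δ ≤ 0 then 1 else 0)

/-- Knight remainder functional `μ(x,y,z)`. -/
noncomputable def muFn (x y z : ℝ) : ℝ :=
  z * y * ∫ s in (0:ℝ)..1, ((if x ≤ y * s then (1:ℝ) else 0) - (if x ≤ 0 then 1 else 0))

/-- Upper smoothed Knight remainder functional `μ_δ^U(x,y,z)`. -/
noncomputable def muU (δ x y z : ℝ) : ℝ :=
  z * y * ∫ s in (0:ℝ)..1, ((if x ≤ y * s then (1:ℝ) else 0) - indU δ x)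

/-- Lower smoothed Knight remainder functional `μ_δ^L(x,y,z)`. -/
noncomputable def muL (δ x y z : ℝ) : ℝ :=
  z * y * ∫ s in (0:ℝ)..1, ((if x ≤ y * s then (1:ℝ) else 0) - indL δ x)

/-- The smoothed indicator `1_δ^L` dominates the indicator of `{x ≤ 0}`. -/
theorem indicator_nonpos_le_indL (δ x : ℝ) : (if x ≤ 0 then (1 : ℝ) else 0) ≤ indL δ x := by
  unfold indL
  refine le_add_of_nonneg_left (mul_nonneg ?_ (by split_ifs <;> norm_num))
  linarith [min_le_right (x / δ) 1]

/-- The smoothed indicator `1_δ^U` is dominated by the indicator of `{x ≤ 0}`. -/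
theorem indU_le_indicator_nonpos {δ : ℝ} (hδ : 0 < δ) (x : ℝ) :
    indU δ x ≤ if x ≤ 0 then (1 : ℝ) else 0 := by
  unfold indU
  rcases le_or_gt (x + δ) 0 with h | h
  · have hx : x ≤ 0 := by linarith
    simp [h, hx, not_lt.mpr h]
  · simp only [h, not_le.mpr h, if_true, if_false, mul_one, add_zero]
    split_ifs with hx
    · have h1 : 0 ≤ x / δ + 1 := by
        rw [div_add_one hδ.ne']
        positivity
      linarith [le_min h1 zero_le_one]
    · have h1 : 0 ≤ x / δ := div_nonneg (not_le.mp hx).le hδ.le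
      rw [min_eq_right (by linarith), sub_self]

/-- The indicator of `{s | x ≤ y * s}` is interval integrable. -/
theorem intervalIntegrable_indicator_le_mul (x y a b : ℝ) :
    IntervalIntegrable (fun s : ℝ => if x ≤ y * s then (1 : ℝ) else 0) MeasureTheory.volume a b := by
  refine (intervalIntegrable_const (c := (1 : ℝ))).mono_fun ?_ (.of_forall fun s => ?_)
  · exact (Measurable.ite (measurableSet_le measurable_const (measurable_const.mul measurable_id))
      measurable_const measurable_const).aestronglyMeasurable
  · dsimp only
    split_ifs <;> simp

/-- The integral `∫₀¹ (1{x ≤ ys} - c) ds` is antitone in `c`. -/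
theorem integral_indicator_le_mul_sub_anti (x y : ℝ) {c d : ℝ} (h : c ≤ d) :
    ∫ s in (0 : ℝ)..1, ((if x ≤ y * s then (1 : ℝ) else 0) - d) ≤
      ∫ s in (0 : ℝ)..1, ((if x ≤ y * s then (1 : ℝ) else 0) - c) :=
  intervalIntegral.integral_mono zero_le_one
    ((intervalIntegrable_indicator_le_mul x y 0 1).sub intervalIntegrable_const)
    ((intervalIntegrable_indicator_le_mul x y 0 1).sub intervalIntegrable_const)
    fun _ => sub_le_sub_left h _

/-- Bracketing of the Knight remainder functional. -/
theorem knight_remainder_bracketing (δ : ℝ) (hδ : 0 < δ) (x y z : ℝ)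
    (hzy : 0 ≤ z * y) :
    muL δ x y z ≤ muFn x y z ∧ muFn x y z ≤ muU δ x y z :=
  ⟨mul_le_mul_of_nonneg_left
      (integral_indicator_le_mul_sub_anti x y (indicator_nonpos_le_indL δ x)) hzy,
    mul_le_mul_of_nonneg_left
      (integral_indicator_le_mul_sub_anti x y (indU_le_indicator_nonpos hδ x)) hzy⟩
end

section
/- Approximation error of the smoothed Knight remainder functionals: for every δ > 0 and all real numbers x, y, z, |μ_δ^U(x,y,z) − μ(x,y,z)| ≤ |z·y|·1{|x| < δ} and |μ_δ^L(x,y,z) − μ(x,y,z)| ≤ |z·y|·1{|x| < δ}. -/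
/-- Replacing the subtracted constant `d` by `c` changes the scaled integral by `|w| * |c - d|`. -/
theorem abs_mul_integral_sub_const_sub (x y w c d : ℝ) :
    |w * (∫ s in (0:ℝ)..1, ((if x ≤ y * s then (1:ℝ) else 0) - c)) -
      w * ∫ s in (0:ℝ)..1, ((if x ≤ y * s then (1:ℝ) else 0) - d)| = |w| * |c - d| := by
  have hf := intervalIntegrable_indicator_le_mul x y 0 1
  rw [intervalIntegral.integral_sub hf intervalIntegrable_const,
    intervalIntegral.integral_sub hf intervalIntegrable_const, ← mul_sub, abs_mul]
  simp [abs_sub_comm]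

theorem abs_indU_sub_le {δ : ℝ} (hδ : 0 < δ) (x : ℝ) :
    |indU δ x - if x ≤ 0 then 1 else 0| ≤ if |x| < δ then 1 else 0 := by
  unfold indU
  rcases le_or_gt x (-δ) with h | h
  · have h1 : ¬ |x| < δ := fun h' => by linarith [(abs_lt.mp h').1]
    have h2 : ¬ 0 < x + δ := by linarith
    simp [h1, h2, not_lt.mp h2, show x ≤ 0 by linarith]
  have h3 : 0 < x + δ := by linarith
  rcases le_or_gt x 0 with h0 | h0
  · have h1 : |x| < δ := abs_lt.mpr ⟨h, by linarith⟩
    have h4 : x / δ ≤ 0 := div_nonpos_of_nonpos_of_nonneg h0 hδ.le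
    have h5 : -1 < x / δ := by rw [lt_div_iff₀ hδ]; linarith
    rw [min_eq_left (by linarith), if_pos h3, if_neg h3.not_ge, if_pos h0, if_pos h1, abs_le]
    constructor <;> linarith
  · have h4 : 0 < x / δ := div_pos h0 hδ
    rw [min_eq_right (by linarith), if_neg h3.not_ge, if_neg h0.not_ge]
    split_ifs <;> simp

theorem abs_indL_sub_le {δ : ℝ} (hδ : 0 < δ) (x : ℝ) :
    |indL δ x - if x ≤ 0 then 1 else 0| ≤ if |x| < δ then 1 else 0 := by
  unfold indL
  rcases le_or_gt x 0 with h0 | h0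
  · rw [if_neg h0.not_gt, if_pos h0]
    split_ifs <;> simp
  rw [if_pos h0, if_neg h0.not_ge, abs_of_pos h0]
  have h4 : 0 < x / δ := div_pos h0 hδ
  rcases lt_or_ge x δ with h | h
  · have h5 : x / δ < 1 := by rwa [div_lt_one hδ]
    rw [if_pos h, min_eq_left h5.le, abs_le]
    constructor <;> linarith
  · rw [if_neg h.not_gt, min_eq_right ((one_le_div hδ).mpr h)]
    simp

/-- Approximation error of the smoothed Knight remainder functionals. -/
theorem knight_remainder_smoothing_error (δ : ℝ) (hδ : 0 < δ) (x y z : ℝ) :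
    |muU δ x y z - muFn x y z| ≤ |z * y| * (if |x| < δ then 1 else 0) ∧
    |muL δ x y z - muFn x y z| ≤ |z * y| * (if |x| < δ then 1 else 0) := by
  unfold muU muL muFn
  rw [abs_mul_integral_sub_const_sub, abs_mul_integral_sub_const_sub]
  exact ⟨mul_le_mul_of_nonneg_left (abs_indU_sub_le hδ x) (abs_nonneg _),
    mul_le_mul_of_nonneg_left (abs_indL_sub_le hδ x) (abs_nonneg _)⟩
end

section
/- Improved second-moment bound for the check-function increment via Knight's identity: let ε be a real-valued random variable on a probability space whose law has a density f with respect to Lebesgue measure satisfying f(t) ≤ M for almost every t ∈ ℝ, for some constant M ≥ 0. Then for every τ ∈ [0,1] and all real numbers x and y, E[(l_τ(ε + x + y) − l_τ(ε + x) − y·(τ − 1{ε + x ≤ 0}))²] ≤ 2·M·|y|³. -/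
open MeasureTheory

/-- The squared remainder of the check function is at most `y ^ 2`, and it vanishes unless `u`
lies between `-y` and `0`. -/
theorem sq_checkFn_remainder_le (τ u y : ℝ) :
    (checkFn τ (u + y) - checkFn τ u - y * (τ - if u ≤ 0 then 1 else 0)) ^ 2
      ≤ (Set.uIcc (-y) 0).indicator (fun _ => y ^ 2) u := by
  unfold checkFn
  by_cases hmem : u ∈ Set.uIcc (-y) 0
  · rw [Set.indicator_of_mem hmem]
    rw [Set.mem_uIcc] at hmem
    split_ifs <;> rcases hmem with h | h <;> nlinarith
  · rw [Set.indicator_of_notMem hmem]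
    rw [Set.mem_uIcc, not_or, not_and, not_and] at hmem
    apply le_of_eq
    split_ifs with h₁ h₂ h₂
    · ring
    · have := hmem.2 (by linarith)
      linarith
    · have := hmem.1 (by linarith)
      linarith
    · ring

/-- A measure with density bounded by `M` is at most `M` times Lebesgue measure on measurable
sets. -/
theorem withDensity_ofReal_apply_le {f : ℝ → ℝ} {M : ℝ} (hfM : ∀ᵐ t ∂volume, f t ≤ M)
    {s : Set ℝ} (hs : MeasurableSet s) :
    volume.withDensity (fun t => ENNReal.ofReal (f t)) s ≤ ENNReal.ofReal M * volume s := by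
  rw [withDensity_apply _ hs, ← setLIntegral_const]
  exact lintegral_mono_ae
    (ae_restrict_of_ae (hfM.mono fun t ht => ENNReal.ofReal_le_ofReal ht))

/-- Improved second-moment bound for the check-function increment via Knight's identity. -/
theorem check_increment_second_moment_bound
    {Ω : Type*} [MeasurableSpace Ω] (μ : Measure Ω) [IsProbabilityMeasure μ]
    (ε : Ω → ℝ) (hε : Measurable ε)
    (f : ℝ → ℝ) (M : ℝ) (hM : 0 ≤ M)
    (hlaw : μ.map ε = volume.withDensity (fun t => ENNReal.ofReal (f t)))
    (hfM : ∀ᵐ t ∂volume, f t ≤ M)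
    (τ : ℝ) (hτ : τ ∈ Set.Icc (0:ℝ) 1) (x y : ℝ) :
    ∫ ω, (checkFn τ (ε ω + x + y) - checkFn τ (ε ω + x)
          - y * (τ - if ε ω + x ≤ 0 then 1 else 0)) ^ 2 ∂μ
      ≤ 2 * M * |y| ^ 3 := by
  have hs : MeasurableSet ((· + x) ⁻¹' Set.uIcc (-y) 0) :=
    measurable_add_const x measurableSet_uIcc
  have hprob : μ.real (ε ⁻¹' ((· + x) ⁻¹' Set.uIcc (-y) 0)) ≤ M * |y| := by
    refine ENNReal.toReal_le_of_le_ofReal (by positivity) ?_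
    rw [← Measure.map_apply hε hs, hlaw]
    refine (withDensity_ofReal_apply_le hfM hs).trans_eq ?_
    rw [measure_preimage_add_right, Real.volume_interval, ENNReal.ofReal_mul hM]
    simp
  calc _ ≤ ∫ ω, (ε ⁻¹' ((· + x) ⁻¹' Set.uIcc (-y) 0)).indicator (fun _ => y ^ 2) ω ∂μ :=
        integral_mono_of_nonneg (.of_forall fun ω => sq_nonneg _)
          ((integrable_const _).indicator (hε hs))
          (.of_forall fun ω => sq_checkFn_remainder_le τ (ε ω + x) y)
    _ = μ.real (ε ⁻¹' ((· + x) ⁻¹' Set.uIcc (-y) 0)) * y ^ 2 := by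
        rw [integral_indicator_const _ (hε hs), smul_eq_mul]
    _ ≤ M * |y| * y ^ 2 := by gcongr
    _ = M * |y| ^ 3 := by rw [← sq_abs y]; ring
    _ ≤ 2 * M * |y| ^ 3 := by
        have : 0 ≤ M * |y| ^ 3 := by positivity
        linarith
end

section
/- Guerre–Sabbah second-moment bound for the integrated indicator increment: let ε be a real-valued random variable on a probability space whose law has a density f with respect to Lebesgue measure satisfying f(t) ≤ M for almost every t ∈ ℝ, for some constant M ≥ 0. Then for all real numbers x and y, E[(∫_x^{x+y} (1{ε ≤ t} − 1{ε ≤ 0}) dt)²] ≤ 2·M·|y|²·(|x| + |y|), where the inner integral is the (signed) interval integral in t. -/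
open MeasureTheory

/-- The integrated increment of the indicator is at most `|y|` in absolute value, and it vanishes
unless `e` lies within `|x| + |y|` of the origin. -/
lemma sq_integral_indicator_increment_le (e x y : ℝ) :
    (∫ t in x..(x + y), ((if e ≤ t then (1:ℝ) else 0) - (if e ≤ 0 then 1 else 0))) ^ 2
      ≤ (Set.Icc (-(|x| + |y|)) (|x| + |y|)).indicator (fun _ => |y| ^ 2) e := by
  have key : ∀ c : ℝ, (∀ t ∈ Set.uIoc x (x + y),
      ‖(if e ≤ t then (1:ℝ) else 0) - (if e ≤ 0 then 1 else 0)‖ ≤ c) →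
      |∫ t in x..(x + y), ((if e ≤ t then (1:ℝ) else 0) - (if e ≤ 0 then 1 else 0))|
        ≤ c * |y| := by
    intro c hc
    simpa using intervalIntegral.norm_integral_le_of_norm_le_const hc
  by_cases he : e ∈ Set.Icc (-(|x| + |y|)) (|x| + |y|)
  · rw [Set.indicator_of_mem he, ← sq_abs]
    refine pow_le_pow_left₀ (abs_nonneg _) ?_ 2
    rw [← one_mul |y|]
    exact key 1 fun t _ => by split_ifs <;> norm_num
  · rw [Set.indicator_of_notMem he, ← sq_abs]
    have h0 := key 0 fun t ht => by
      have h1 : |t| ≤ |x| + |y| := by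
        have hx := abs_le.1 (le_refl |x|)
        have hy := abs_le.1 (le_refl |y|)
        have hxn := abs_nonneg x
        have hyn := abs_nonneg y
        rw [abs_le]
        rcases Set.mem_uIoc.1 ht with h | h <;> constructor <;> linarith [h.1, h.2]
      have h2 := abs_le.1 h1
      have h3 : 0 ≤ |x| + |y| := by positivity
      rw [Set.mem_Icc, not_and_or, not_le, not_le] at he
      rcases he with he | he
      · rw [if_pos (by linarith), if_pos (by linarith)]; simp
      · rw [if_neg (by linarith), if_neg (by linarith)]; simp
    rw [zero_mul] at h0
    rw [le_antisymm h0 (abs_nonneg _)]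
    norm_num

/-- A measure with density bounded by `M` gives an interval mass at most `M` times its length. -/
lemma withDensity_Icc_le_of_ae_le {f : ℝ → ℝ} {M : ℝ} (hM : 0 ≤ M)
    (hfM : ∀ᵐ t ∂volume, f t ≤ M) (a b : ℝ) :
    volume.withDensity (fun t => ENNReal.ofReal (f t)) (Set.Icc a b)
      ≤ ENNReal.ofReal (M * (b - a)) := by
  rw [withDensity_apply _ measurableSet_Icc, ENNReal.ofReal_mul hM, ← Real.volume_Icc,
    ← setLIntegral_const]
  exact lintegral_mono_ae (ae_restrict_of_ae (hfM.mono fun t ht => ENNReal.ofReal_le_ofReal ht))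

/-- Guerre–Sabbah second-moment bound for the integrated indicator increment. -/
theorem integrated_indicator_increment_second_moment_bound
    {Ω : Type*} [MeasurableSpace Ω] (μ : Measure Ω) [IsProbabilityMeasure μ]
    (ε : Ω → ℝ) (hε : Measurable ε)
    (f : ℝ → ℝ) (M : ℝ) (hM : 0 ≤ M)
    (hlaw : μ.map ε = volume.withDensity (fun t => ENNReal.ofReal (f t)))
    (hfM : ∀ᵐ t ∂volume, f t ≤ M)
    (x y : ℝ) :
    ∫ ω, (∫ t in x..(x + y),
            ((if ε ω ≤ t then (1:ℝ) else 0) - (if ε ω ≤ 0 then 1 else 0))) ^ 2 ∂μ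
      ≤ 2 * M * |y| ^ 2 * (|x| + |y|) := by
  set a := |x| + |y| with ha
  have ha0 : 0 ≤ a := by positivity
  have hS : MeasurableSet (ε ⁻¹' Set.Icc (-a) a) := hε measurableSet_Icc
  have hmass : μ.real (ε ⁻¹' Set.Icc (-a) a) ≤ M * (a - -a) := by
    refine ENNReal.toReal_le_of_le_ofReal (mul_nonneg hM (by linarith)) ?_
    rw [← Measure.map_apply hε measurableSet_Icc, hlaw]
    exact withDensity_Icc_le_of_ae_le hM hfM _ _
  calc _ ≤ ∫ ω, (ε ⁻¹' Set.Icc (-a) a).indicator (fun _ => |y| ^ 2) ω ∂μ :=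
        integral_mono_of_nonneg (.of_forall fun ω => sq_nonneg _)
          ((integrable_const _).indicator hS)
          (.of_forall fun ω => sq_integral_indicator_increment_le (ε ω) x y)
    _ = μ.real (ε ⁻¹' Set.Icc (-a) a) * |y| ^ 2 := by
        rw [integral_indicator_const _ hS, smul_eq_mul]
    _ ≤ M * (a - -a) * |y| ^ 2 := by gcongr
    _ = 2 * M * |y| ^ 2 * a := by ring
end
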